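/- Consider the QMC-SA recursion on X = [0,1] driven by a deterministic (t,1)-sequence (u^n)_{n≥0} in base b ≥ 2 and by a (0,1)-sequence (v^n)_{n≥0} in base b satisfying v^0 = 0, where the Markov kernel K on [0,1] satisfies Assumptions A1 and A2, φ satisfies the level-set condition (with d = 1), and the nonincreasing positive temperatures satisfy Σ_{n≥2} T_n log n < ∞. Then φ(x^n) → φ* as n → ∞. -/

import Mathlib

open MeasureTheory ProbabilityTheory Set Filter
open scoped Classical

/-- The closed unit cube `[0,1]^d` in `ℝ^d` (modeled as `Fin d → ℝ` with the sup norm). -/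
def cube (d : ℕ) : Set (Fin d → ℝ) := {x | ∀ i, x i ∈ Set.Icc (0:ℝ) 1}

/-- Membership in the `b`-ary box `∏_j [c_j b^{-e_j}, (c_j+1) b^{-e_j})`. -/
def inBaryBox {d : ℕ} (b : ℕ) (e c : Fin d → ℕ) (x : Fin d → ℝ) : Prop :=
  ∀ j, (c j : ℝ) / (b : ℝ) ^ (e j) ≤ x j ∧ x j < ((c j : ℝ) + 1) / (b : ℝ) ^ (e j)

/-- The block `{u^n : A ≤ n < A + b^m}` is a `(t,m,d)`-net in base `b`: every `b`-ary box of
volume `b^{t-m}` contains exactly `b^t` points of the block. -/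
def IsNetBlock {d : ℕ} (b t m : ℕ) (u : ℕ → Fin d → ℝ) (A : ℕ) : Prop :=
  ∀ e c : Fin d → ℕ, (∀ j, c j < b ^ (e j)) → (∑ j, e j) = m - t →
    ((Finset.Ico A (A + b ^ m)).filter (fun n => inBaryBox b e c (u n))).card = b ^ t

/-- `(u^n)_{n≥0}` is a `(t,d)`-sequence in base `b`. -/
def IsTSeq {d : ℕ} (b t : ℕ) (u : ℕ → Fin d → ℝ) : Prop :=
  (∀ n i, u n i ∈ Set.Ico (0:ℝ) 1) ∧
  ∀ a m : ℕ, t ≤ m → IsNetBlock b t m u (a * b ^ m)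

/-- `(v^n)_{n≥0}` is a scalar `(t,1)`-sequence in base `b`. -/
def IsTSeq1 (b t : ℕ) (v : ℕ → ℝ) : Prop :=
  (∀ n, v n ∈ Set.Ico (0:ℝ) 1) ∧
  ∀ a m : ℕ, t ≤ m → ∀ c : ℕ, c < b ^ (m - t) →
    ((Finset.Ico (a * b ^ m) (a * b ^ m + b ^ m)).filter
      (fun n => (c : ℝ) / (b:ℝ) ^ (m - t) ≤ v n ∧ v n < ((c : ℝ) + 1) / (b:ℝ) ^ (m - t))).card
      = b ^ t

/-- `k_n`: the smallest integer `k` such that `n < b^k`. -/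
noncomputable def kOf (b n : ℕ) : ℕ := sInf {k | n < b ^ k}

/-- For `d = 1` the Rosenblatt transform is the conditional CDF `F_K(x,y) = ∫_0^y K(s|x) ds`. -/
noncomputable def cdf1 (κ : ℝ → ℝ → ℝ) (x y : ℝ) : ℝ := ∫ s in (0:ℝ)..y, κ x s

/-- Assumption (A1), scalar case: `y ↦ F_K(x,y)` is strictly increasing on `[0,1]`. -/
def A1s (κ : ℝ → ℝ → ℝ) : Prop :=
  ∀ x ∈ Set.Icc (0:ℝ) 1, StrictMonoOn (cdf1 κ x) (Set.Icc 0 1)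

/-- Assumption (A2), scalar case. -/
def A2s (κ : ℝ → ℝ → ℝ) (Klow : ℝ) : Prop :=
  ContinuousOn (fun p : ℝ × ℝ => κ p.1 p.2) ((Set.Icc (0:ℝ) 1) ×ˢ (Set.Icc (0:ℝ) 1)) ∧
  0 < Klow ∧ ∀ x ∈ Set.Icc (0:ℝ) 1, ∀ y ∈ Set.Icc (0:ℝ) 1, Klow ≤ κ x y

/-- `κ` is a probability density in its second argument, w.r.t. Lebesgue measure on `[0,1]`. -/
def IsMarkovDensity1 (κ : ℝ → ℝ → ℝ) : Prop :=
  ∀ x ∈ Set.Icc (0:ℝ) 1, (∀ y ∈ Set.Icc (0:ℝ) 1, 0 ≤ κ x y) ∧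
    ∫ y in Set.Icc (0:ℝ) 1, κ x y = 1

/-- `G` is the inverse of the CDF `F_K(x, ·)` (the scalar inverse Rosenblatt transform). -/
def IsInvRos1 (κ : ℝ → ℝ → ℝ) (G : ℝ → ℝ → ℝ) : Prop :=
  ∀ x ∈ Set.Icc (0:ℝ) 1, ∀ u ∈ Set.Icc (0:ℝ) 1,
    G x u ∈ Set.Icc (0:ℝ) 1 ∧ cdf1 κ x (G x u) = u

/-- The `ε`-enlargement of `A ⊆ [0,1]`. -/
def enlarge1 (A : Set ℝ) (ε : ℝ) : Set ℝ := {x ∈ Set.Icc (0:ℝ) 1 | ∃ x' ∈ A, |x - x'| ≤ ε}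

/-- `A` has Minkowski content `M` (scalar case). -/
def HasMinkContent1 (A : Set ℝ) (M : ℝ) : Prop :=
  Tendsto (fun ε : ℝ => (volume (enlarge1 A ε)).toReal / ε)
    (nhdsWithin 0 (Set.Ioi 0)) (nhds M)

/-- The level-set condition on `φ : [0,1] → ℝ`. -/
def LevelSetCondition1 (φ : ℝ → ℝ) : Prop :=
  ContinuousOn φ (Set.Icc 0 1) ∧
  ∃ Mbar : ℝ, ∀ x ∈ Set.Icc (0:ℝ) 1, φ x < sSup (φ '' Set.Icc 0 1) →
    ∃ M : ℝ, HasMinkContent1 {x' ∈ Set.Icc (0:ℝ) 1 | φ x' = φ x} M ∧ M ≤ Mbar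

/-- A clamp of the kernel to the unit square, continuous on the whole plane. -/
noncomputable def clampKernel (κ : ℝ → ℝ → ℝ) (x y : ℝ) : ℝ :=
  κ (projIcc (0:ℝ) 1 zero_le_one x) (projIcc (0:ℝ) 1 zero_le_one y)

lemma clampKernel_of_mem (κ : ℝ → ℝ → ℝ) {x y : ℝ} (hx : x ∈ Set.Icc (0:ℝ) 1)
    (hy : y ∈ Set.Icc (0:ℝ) 1) : clampKernel κ x y = κ x y := by
  simp [clampKernel, projIcc_of_mem zero_le_one hx, projIcc_of_mem zero_le_one hy]

lemma continuous_clampKernel {κ : ℝ → ℝ → ℝ} {Klow : ℝ} (h : A2s κ Klow) :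
    Continuous (Function.uncurry (clampKernel κ)) := by
  have hc : Continuous (fun p : ℝ × ℝ =>
      (((projIcc (0:ℝ) 1 zero_le_one p.1 : Set.Icc (0:ℝ) 1) : ℝ),
        ((projIcc (0:ℝ) 1 zero_le_one p.2 : Set.Icc (0:ℝ) 1) : ℝ))) := by
    fun_prop
  exact h.1.comp_continuous hc fun p => ⟨Subtype.coe_prop _, Subtype.coe_prop _⟩

lemma cdf1_eq_clampKernel (κ : ℝ → ℝ → ℝ) {x y : ℝ} (hx : x ∈ Set.Icc (0:ℝ) 1)
    (hy : y ∈ Set.Icc (0:ℝ) 1) : cdf1 κ x y = cdf1 (clampKernel κ) x y := by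
  unfold cdf1
  refine intervalIntegral.integral_congr fun s hs => ?_
  rw [uIcc_of_le hy.1] at hs
  exact (clampKernel_of_mem κ hx ⟨hs.1, hs.2.trans hy.2⟩).symm

lemma continuousOn_cdf1 {κ : ℝ → ℝ → ℝ} {Klow : ℝ} (h : A2s κ Klow) :
    ContinuousOn (fun p : ℝ × ℝ => cdf1 κ p.1 p.2) (Set.Icc (0:ℝ) 1 ×ˢ Set.Icc (0:ℝ) 1) := by
  have hc : Continuous (fun p : ℝ × ℝ => cdf1 (clampKernel κ) p.1 p.2) := by
    have hf : Continuous (Function.uncurry fun (p : ℝ × ℝ) (s : ℝ) => clampKernel κ p.1 s) :=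
      (continuous_clampKernel h).comp
        ((continuous_fst.comp continuous_fst).prodMk continuous_snd)
    exact intervalIntegral.continuous_parametric_intervalIntegral_of_continuous hf continuous_snd
  exact hc.continuousOn.congr fun p hp => cdf1_eq_clampKernel κ hp.1 hp.2

lemma cdf1_sub_ge {κ : ℝ → ℝ → ℝ} {Klow : ℝ} (h : A2s κ Klow) {x a c : ℝ}
    (hx : x ∈ Set.Icc (0:ℝ) 1) (ha : 0 ≤ a) (hac : a ≤ c) (hc : c ≤ 1) :
    Klow * (c - a) ≤ cdf1 κ x c - cdf1 κ x a := by
  have hcont : Continuous (clampKernel κ x) :=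
    (continuous_clampKernel h).comp (continuous_const.prodMk continuous_id)
  have hint : ∀ p q : ℝ, IntervalIntegrable (clampKernel κ x) volume p q :=
    fun p q => hcont.intervalIntegrable p q
  rw [cdf1_eq_clampKernel κ hx ⟨ha.trans hac, hc⟩, cdf1_eq_clampKernel κ hx ⟨ha, hac.trans hc⟩]
  unfold cdf1
  rw [intervalIntegral.integral_interval_sub_left (hint _ _) (hint _ _)]
  calc Klow * (c - a) = ∫ _ in a..c, Klow := by simp [mul_comm]
    _ ≤ _ := intervalIntegral.integral_mono_on hac (by simp) (hint _ _) fun s hs => by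
      rw [clampKernel_of_mem κ hx ⟨ha.trans hs.1, hs.2.trans hc⟩]
      exact h.2.2 x hx s ⟨ha.trans hs.1, hs.2.trans hc⟩

/-- A point of the unit interval is an endpoint of a subinterval of any length `ε ≤ 1/2`. -/
lemma exists_Icc_add_subset_unit {p ε : ℝ} (hp : p ∈ Set.Icc (0:ℝ) 1) (h0 : 0 ≤ ε)
    (h1 : ε ≤ 1 / 2) :
    ∃ a, Set.Icc a (a + ε) ⊆ Set.Icc (0:ℝ) 1 ∧ ∀ z ∈ Set.Icc a (a + ε), |z - p| ≤ ε := by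
  obtain ⟨hp0, hp1⟩ := hp
  rcases le_total p (1 / 2) with h | h
  · refine ⟨p, Set.Icc_subset_Icc hp0 (by linarith), fun z hz => ?_⟩
    rw [abs_le]; constructor <;> linarith [hz.1, hz.2]
  · refine ⟨p - ε, Set.Icc_subset_Icc (by linarith) (by linarith), fun z hz => ?_⟩
    rw [abs_le]; constructor <;> linarith [hz.1, hz.2]

lemma card_mul_le_volume_enlarge1 {A : Set ℝ} (hA : A ⊆ Set.Icc 0 1) (s : Finset ℝ)
    (hs : (s : Set ℝ) ⊆ A) {ε : ℝ} (h0 : 0 ≤ ε) (h1 : ε ≤ 1 / 2)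
    (hsep : ∀ p ∈ s, ∀ q ∈ s, p ≠ q → 2 * ε < |p - q|) :
    s.card * ε ≤ (volume (enlarge1 A ε)).toReal := by
  choose! a ha using fun p (hp : p ∈ s) => exists_Icc_add_subset_unit (hA (hs hp)) h0 h1
  have hdisj : (s : Set ℝ).PairwiseDisjoint fun p => Set.Icc (a p) (a p + ε) := by
    intro p hp q hq hpq
    refine Set.disjoint_left.2 fun z hz hz' => ?_
    have hzp := (ha p hp).2 z hz
    have hzq := (ha q hq).2 z hz'
    have := hsep p hp q hq hpq
    have := abs_sub_le p z q
    rw [abs_sub_comm p z] at this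
    linarith
  have hvol : volume (⋃ p ∈ s, Set.Icc (a p) (a p + ε)) = ENNReal.ofReal (s.card * ε) := by
    rw [measure_biUnion_finset hdisj fun p _ => measurableSet_Icc]
    simp [ENNReal.ofReal_mul]
  have hsub : (⋃ p ∈ s, Set.Icc (a p) (a p + ε)) ⊆ enlarge1 A ε := by
    refine Set.iUnion₂_subset fun p hp z hz => ?_
    exact ⟨(ha p hp).1 hz, p, hs hp, (ha p hp).2 z hz⟩
  have hfin : volume (enlarge1 A ε) ≠ ⊤ :=
    ((measure_mono fun z hz => hz.1).trans_lt
      (measure_Icc_lt_top (a := (0:ℝ)) (b := 1))).ne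
  have := ENNReal.toReal_mono hfin (measure_mono hsub)
  rwa [hvol, ENNReal.toReal_ofReal (by positivity)] at this

/-- A subset of the unit interval with a finite Minkowski content is finite. -/
lemma HasMinkContent1.finite {A : Set ℝ} {M : ℝ} (hA : A ⊆ Set.Icc 0 1)
    (h : HasMinkContent1 A M) : A.Finite := by
  by_contra hinf
  obtain ⟨N, hN⟩ := exists_nat_gt (M + 1)
  obtain ⟨s, hsA, hsN⟩ := Set.Infinite.exists_subset_card_eq hinf N
  have hsep : ∀ᶠ ε : ℝ in nhdsWithin 0 (Set.Ioi 0),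
      ∀ p ∈ s, ∀ q ∈ s, p ≠ q → 2 * ε < |p - q| := by
    refine (Filter.eventually_all_finset s).2 fun p _ =>
      (Filter.eventually_all_finset s).2 fun q _ => ?_
    by_cases hpq : p = q
    · exact Filter.Eventually.of_forall fun ε hne => absurd hpq hne
    · have hpos : 0 < |p - q| / 2 := by have := abs_pos.2 (sub_ne_zero.2 hpq); linarith
      filter_upwards [nhdsWithin_le_nhds (Iio_mem_nhds hpos)] with ε hε _
      have : ε < |p - q| / 2 := hε
      linarith
  have hlim := h.eventually (gt_mem_nhds (show M < M + 1 by linarith))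
  have hhalf : ∀ᶠ ε : ℝ in nhdsWithin 0 (Set.Ioi 0), ε < 1 / 2 :=
    nhdsWithin_le_nhds (Iio_mem_nhds (by norm_num))
  obtain ⟨ε, h1, h2, h3, h4⟩ :=
    (hsep.and (hlim.and (hhalf.and self_mem_nhdsWithin))).exists
  have hε : 0 < ε := h4
  have hcard := card_mul_le_volume_enlarge1 hA s hsA hε.le h3.le h1
  rw [div_lt_iff₀ hε] at h2
  rw [hsN] at hcard
  nlinarith

lemma IsTSeq1.inv_pow_le {b : ℕ} (hb : 2 ≤ b) {v : ℕ → ℝ} (hv : IsTSeq1 b 0 v) (hv0 : v 0 = 0)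
    {n k : ℕ} (hn : n ≠ 0) (hk : n < b ^ k) : 1 / (b:ℝ) ^ k ≤ v n := by
  by_contra! hlt
  have hb0 : 0 < b := by omega
  have hcard := hv.2 0 k (Nat.zero_le _) 0 (by positivity)
  rw [pow_zero, Finset.card_eq_one] at hcard
  obtain ⟨w, hw⟩ := hcard
  have hbk : (0:ℝ) < (b:ℝ) ^ k := by positivity
  have h0 : (0:ℕ) = w := by
    rw [← Finset.mem_singleton, ← hw]
    simp [hv0, hb0, hbk]
  have h1 : n = w := by
    rw [← Finset.mem_singleton, ← hw]
    simp only [zero_mul, zero_add, Finset.mem_filter, Finset.mem_Ico, Nat.zero_le, true_and,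
      Nat.cast_zero, zero_div, Nat.sub_zero]
    exact ⟨hk, (hv.1 n).1, hlt⟩
  omega

lemma IsTSeq1.neg_log_le {b : ℕ} (hb : 2 ≤ b) {v : ℕ → ℝ} (hv : IsTSeq1 b 0 v) (hv0 : v 0 = 0)
    {n : ℕ} (hn : n ≠ 0) : 0 < v n ∧ -(Real.log n + Real.log b) ≤ Real.log (v n) := by
  have hlow := hv.inv_pow_le hb hv0 hn (Nat.lt_pow_succ_log_self (show 1 < b by omega) n)
  have hbR : (0:ℝ) < b := by exact_mod_cast (show 0 < b by omega)
  have hnR : (0:ℝ) < n := by exact_mod_cast Nat.pos_of_ne_zero hn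
  have hpow : (b:ℝ) ^ (Nat.log b n + 1) ≤ n * b := by
    rw [pow_succ]
    gcongr
    exact_mod_cast Nat.pow_log_le_self b hn
  have hinv : 1 / ((n:ℝ) * b) ≤ v n :=
    (one_div_le_one_div_of_le (by positivity) hpow).trans hlow
  have hpos : 0 < 1 / ((n:ℝ) * b) := by positivity
  refine ⟨hpos.trans_le hinv, ?_⟩
  have := Real.log_le_log hpos hinv
  rwa [one_div, Real.log_inv, Real.log_mul hnR.ne' hbR.ne'] at this

lemma summable_of_summable_mul_log {T : ℕ → ℝ} (hT : ∀ n, 0 < T n)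
    (h : Summable fun n => T n * Real.log n) : Summable T := by
  have h2 : 0 < Real.log 2 := Real.log_pos (by norm_num)
  refine Summable.of_norm_bounded_eventually_nat (h.mul_right (Real.log 2)⁻¹) ?_
  filter_upwards [eventually_ge_atTop 2] with n hn
  have : Real.log 2 ≤ Real.log n := Real.log_le_log (by norm_num) (by exact_mod_cast hn)
  rw [Real.norm_of_nonneg (hT n).le, ← div_eq_mul_inv, le_div_iff₀ h2]
  exact mul_le_mul_of_nonneg_left this (hT n).le

/-- A bounded real sequence whose decrements are summable converges. -/
lemma exists_tendsto_of_sub_le {f c : ℕ → ℝ} {B : ℝ} (hB : ∀ n, f n ≤ B)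
    (hc : Summable c) (hc0 : ∀ n, 0 ≤ c n) (h : ∀ n, f n - c n ≤ f (n + 1)) :
    ∃ L, Tendsto f atTop (nhds L) := by
  have hmono : Monotone fun n => f n + ∑ i ∈ Finset.range n, c i := by
    refine monotone_nat_of_le_succ fun n => ?_
    rw [Finset.sum_range_succ]
    linarith [h n]
  have hbdd : BddAbove (Set.range fun n => f n + ∑ i ∈ Finset.range n, c i) := by
    refine ⟨B + ∑' i, c i, ?_⟩
    rintro _ ⟨n, rfl⟩
    exact add_le_add (hB n) (hc.sum_le_tsum _ fun i _ => hc0 i)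
  have := (tendsto_atTop_ciSup hmono hbdd).sub hc.hasSum.tendsto_sum_nat
  exact ⟨_, by simpa using this⟩

lemma IsTSeq1.card_near_le {b t : ℕ} (hb : 2 ≤ b) {u : ℕ → ℝ} (hu : IsTSeq1 b t u)
    (a : ℕ) {m : ℕ} (hm : t ≤ m) (S : Finset ℝ) :
    ((Finset.Ico (a * b ^ m) (a * b ^ m + b ^ m)).filter
      (fun n => ∃ s ∈ S, |u n - s| < 1 / (b:ℝ) ^ (m - t))).card ≤ S.card * (3 * b ^ t) := by
  set q : ℝ := (b:ℝ) ^ (m - t) with hq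
  have hq0 : 0 < q := by
    have : (0:ℝ) < b := by exact_mod_cast (show 0 < b by omega)
    positivity
  set box : ℕ → Finset ℕ := fun c => (Finset.Ico (a * b ^ m) (a * b ^ m + b ^ m)).filter
      (fun n => (c : ℝ) / q ≤ u n ∧ u n < ((c : ℝ) + 1) / q) with hbox
  have hboxcard : ∀ c, (box c).card ≤ b ^ t := by
    intro c
    by_cases hc : c < b ^ (m - t)
    · exact (hu.2 a m hm c hc).le
    · have : box c = ∅ := by
        refine Finset.filter_eq_empty_iff.2 fun n _ hn => ?_
        have h1 : (1:ℝ) ≤ c / q := by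
          rw [le_div_iff₀ hq0, one_mul, hq]
          exact_mod_cast not_lt.1 hc
        linarith [(hu.1 n).2, hn.1]
      simp [this]
  have hsub : ((Finset.Ico (a * b ^ m) (a * b ^ m + b ^ m)).filter
      (fun n => ∃ s ∈ S, |u n - s| < 1 / q)) ⊆
      S.biUnion fun s => (Finset.Icc (⌊s * q⌋₊ - 1) (⌊s * q⌋₊ + 1)).biUnion box := by
    intro n hn
    obtain ⟨hnI, s, hs, hd⟩ := Finset.mem_filter.1 hn
    have hu0 : 0 ≤ u n * q := mul_nonneg (hu.1 n).1 hq0.le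
    simp only [Finset.mem_biUnion, hbox, Finset.mem_filter]
    refine ⟨s, hs, ⌊u n * q⌋₊, ?_, hnI, ?_, ?_⟩
    · have hd' : |u n * q - s * q| < 1 := by
        rwa [← sub_mul, abs_mul, abs_of_pos hq0, ← lt_div_iff₀ hq0]
      rw [abs_lt] at hd'
      have h1 := Nat.floor_le hu0
      have h2 := Nat.lt_floor_add_one (u n * q)
      have h3 := Nat.lt_floor_add_one (s * q)
      rw [Finset.mem_Icc]
      constructor
      · rcases le_or_gt 0 (s * q) with h0 | h0
        · have h4 := Nat.floor_le h0
          have : ((⌊s * q⌋₊ : ℕ) : ℝ) < ((⌊u n * q⌋₊ + 2 : ℕ) : ℝ) := by push_cast; linarith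
          have := Nat.cast_lt.1 this
          omega
        · simp [Nat.floor_of_nonpos h0.le]
      · have : ((⌊u n * q⌋₊ : ℕ) : ℝ) < ((⌊s * q⌋₊ + 2 : ℕ) : ℝ) := by push_cast; linarith
        have := Nat.cast_lt.1 this
        omega
    · rw [div_le_iff₀ hq0]; exact Nat.floor_le hu0
    · rw [lt_div_iff₀ hq0]; exact Nat.lt_floor_add_one _
  refine (Finset.card_le_card hsub).trans (Finset.card_biUnion_le_card_mul _ _ _ fun s _ => ?_)
  refine (Finset.card_biUnion_le_card_mul _ _ _ fun c _ => hboxcard c).trans ?_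
  gcongr
  rw [Nat.card_Icc]
  omega

/-- Every interval `[p, p + ℓ]` with `2 b^{t-m} ≤ ℓ` is visited in each aligned block of
length `b^m`. -/
lemma IsTSeq1.exists_mem_Icc {b t : ℕ} (hb : 2 ≤ b) {u : ℕ → ℝ} (hu : IsTSeq1 b t u)
    (a : ℕ) {m : ℕ} (hm : t ≤ m) {p r : ℝ} (hp : 0 ≤ p) (hr : r ≤ 1)
    (hpr : p + 2 / (b:ℝ) ^ (m - t) ≤ r) :
    ∃ n, a * b ^ m ≤ n ∧ n < a * b ^ m + b ^ m ∧ p ≤ u n ∧ u n ≤ r := by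
  set q : ℝ := (b:ℝ) ^ (m - t) with hq
  have hb0 : 0 < b := by omega
  have hq0 : 0 < q := by
    have : (0:ℝ) < b := by exact_mod_cast hb0
    positivity
  have hpq : p * q + 2 ≤ r * q := by
    have := mul_le_mul_of_nonneg_right hpr hq0.le
    rwa [add_mul, div_mul_cancel₀ _ hq0.ne'] at this
  have h1 := Nat.le_ceil (p * q)
  have h2 := Nat.ceil_lt_add_one (mul_nonneg hp hq0.le)
  have hrq : r * q ≤ q := by nlinarith
  have hc : ⌈p * q⌉₊ < b ^ (m - t) := by
    have : ((⌈p * q⌉₊ : ℕ) : ℝ) < ((b ^ (m - t) : ℕ) : ℝ) := by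
      push_cast; rw [← hq]; linarith
    exact_mod_cast this
  have hcard := hu.2 a m hm _ hc
  have hne := Finset.card_pos.1 (hcard ▸ (by positivity : 0 < b ^ t))
  obtain ⟨n, hn⟩ := hne
  rw [Finset.mem_filter, Finset.mem_Ico] at hn
  obtain ⟨⟨hn1, hn2⟩, hn3, hn4⟩ := hn
  refine ⟨n, hn1, hn2, ?_, ?_⟩
  · refine le_trans ?_ hn3
    rw [le_div_iff₀ hq0]; exact h1
  · refine hn4.le.trans ?_
    rw [div_le_iff₀ hq0]; linarith

/-- Beyond any rank there is an aligned block of length `b^m` along which `u` stays away from a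
given finite set; the distance depends only on the set and on `m`. -/
lemma IsTSeq1.exists_block_avoiding {b t : ℕ} (hb : 2 ≤ b) {u : ℕ → ℝ} (hu : IsTSeq1 b t u)
    {m : ℕ} (hm : t ≤ m) (S : Finset ℝ) :
    ∃ η > 0, ∀ N : ℕ, ∃ a : ℕ, N ≤ a * b ^ m ∧
      ∀ n, a * b ^ m ≤ n → n < a * b ^ m + b ^ m → ∀ s ∈ S, η ≤ |u n - s| := by
  have hb0 : 0 < b := by omega
  obtain ⟨r, hr⟩ := pow_unbounded_of_one_lt (S.card * (3 * b ^ t)) (show 1 < b by omega)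
  refine ⟨1 / (b:ℝ) ^ (m + r - t), by positivity, fun N => ?_⟩
  by_contra! hbad
  have hcard := hu.card_near_le hb N (show t ≤ m + r by omega) S
  have hbm : 0 < b ^ m := by positivity
  have hbr : 0 < b ^ r := by positivity
  have hstart : ∀ j, N ≤ (N * b ^ r + j) * b ^ m := fun j => by nlinarith [Nat.mul_le_mul hbr hbm]
  choose f hf1 hf2 s hs hfs using fun j => hbad (N * b ^ r + j) (hstart j)
  have hdiv : ∀ j, f j / b ^ m = N * b ^ r + j := fun j =>
    Nat.div_eq_of_lt_le (hf1 j) (by have := hf2 j; rw [add_one_mul]; exact this)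
  have hinj : Function.Injective f := fun i j hij => by
    have h1 := hdiv i
    have h2 := hdiv j
    rw [hij] at h1
    omega
  have hsub : (Finset.range (b ^ r)).image f ⊆
      (Finset.Ico (N * b ^ (m + r)) (N * b ^ (m + r) + b ^ (m + r))).filter
      (fun n => ∃ s ∈ S, |u n - s| < 1 / (b:ℝ) ^ (m + r - t)) := by
    intro n hn
    obtain ⟨j, hj, rfl⟩ := Finset.mem_image.1 hn
    have hjr : j + 1 ≤ b ^ r := Finset.mem_range.1 hj
    have h1 := hf1 j
    have h2 := hf2 j
    have h3 := Nat.mul_le_mul_right (b ^ m) hjr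
    rw [Finset.mem_filter, Finset.mem_Ico, pow_add]
    refine ⟨⟨by nlinarith, by nlinarith⟩, s j, hs j, hfs j⟩
  have := Finset.card_le_card hsub
  rw [Finset.card_image_of_injective _ hinj, Finset.card_range] at this
  omega

/-- If a level set is finite, pairs of points whose values are close to that level have a CDF
value close to one of finitely many reals. -/
lemma exists_forall_cdf1_near {κ : ℝ → ℝ → ℝ} {Klow : ℝ} (h : A2s κ Klow) {φ : ℝ → ℝ}
    (hφ : ContinuousOn φ (Set.Icc 0 1)) {L : ℝ} {S : Finset ℝ}
    (hS : ∀ x ∈ Set.Icc (0:ℝ) 1, ∀ y ∈ Set.Icc (0:ℝ) 1, φ x = L → φ y = L → cdf1 κ x y ∈ S)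
    {η : ℝ} (hη : 0 < η) :
    ∃ δ > 0, ∀ x ∈ Set.Icc (0:ℝ) 1, ∀ y ∈ Set.Icc (0:ℝ) 1, |φ x - L| < δ → |φ y - L| < δ →
      ∃ s ∈ S, |cdf1 κ x y - s| < η := by
  by_contra! hcon
  choose x hx y hy hφx hφy hfar using
    fun n : ℕ => hcon (1 / ((n:ℝ) + 1)) Nat.one_div_pos_of_nat
  obtain ⟨⟨p, q⟩, hpq, ψ, hψ, hlim⟩ :=
    (isCompact_Icc.prod isCompact_Icc).tendsto_subseq (x := fun n => (x n, y n))
      fun n => (⟨hx n, hy n⟩ : _ ∈ Set.Icc (0:ℝ) 1 ×ˢ Set.Icc (0:ℝ) 1)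
  have hmem : ∀ n, (x (ψ n), y (ψ n)) ∈ Set.Icc (0:ℝ) 1 ×ˢ Set.Icc (0:ℝ) 1 :=
    fun n => ⟨hx _, hy _⟩
  have hF := ((continuousOn_cdf1 h) _ hpq).tendsto.comp
    (tendsto_nhdsWithin_iff.2 ⟨hlim, Filter.Eventually.of_forall hmem⟩)
  have hsmall : Tendsto (fun n : ℕ => 1 / ((ψ n : ℝ) + 1)) atTop (nhds 0) :=
    tendsto_one_div_add_atTop_nhds_zero_nat.comp hψ.tendsto_atTop
  have hlevel : ∀ {z : ℕ → ℝ} {l : ℝ}, l ∈ Set.Icc (0:ℝ) 1 → (∀ n, z n ∈ Set.Icc (0:ℝ) 1) →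
      (∀ n, |φ (z n) - L| < 1 / ((n:ℝ) + 1)) → Tendsto (z ∘ ψ) atTop (nhds l) → φ l = L := by
    intro z l hl hz hzL hzl
    have h1 := (hφ l hl).tendsto.comp
      (tendsto_nhdsWithin_iff.2 ⟨hzl, Filter.Eventually.of_forall fun n => hz (ψ n)⟩)
    have h2 : Tendsto (fun n => φ (z (ψ n)) - L) atTop (nhds 0) :=
      squeeze_zero_norm (fun n => (hzL (ψ n)).le) hsmall
    have h3 := h2.add_const L
    simp only [sub_add_cancel, zero_add] at h3
    exact tendsto_nhds_unique h1 h3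
  have hp : φ p = L := hlevel hpq.1 hx hφx ((continuous_fst.tendsto _).comp hlim)
  have hq : φ q = L := hlevel hpq.2 hy hφy ((continuous_snd.tendsto _).comp hlim)
  have hdist := (hF.sub_const (cdf1 κ p q)).abs
  simp only [sub_self, abs_zero] at hdist
  have hle := ge_of_tendsto' hdist fun n => hfar (ψ n) _ (hS p hpq.1 q hpq.2 hp hq)
  linarith

/-- **Theorem 2 (univariate deterministic QMC-SA).** On `X = [0,1]`, for the QMC-SA recursion
driven by a deterministic `(t,1)`-sequence and a `(0,1)`-sequence `v` with `v 0 = 0`, if the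
kernel satisfies (A1)-(A2), `φ` satisfies the level-set condition and `Σ T_n log n < ∞`, then
`φ(x^n) → φ* = sup_{x ∈ [0,1]} φ(x)`. -/
theorem qmcsa_univariate_converges
    {b t : ℕ} (hb : 2 ≤ b)
    (u : ℕ → ℝ) (hu : IsTSeq1 b t u)
    (v : ℕ → ℝ) (hv : IsTSeq1 b 0 v) (hv0 : v 0 = 0)
    (κ : ℝ → ℝ → ℝ) (hκ : IsMarkovDensity1 κ)
    (hA1 : A1s κ) (Klow : ℝ) (hA2 : A2s κ Klow)
    (G : ℝ → ℝ → ℝ) (hG : IsInvRos1 κ G)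
    (φ : ℝ → ℝ) (hφ : LevelSetCondition1 φ)
    (T : ℕ → ℝ) (hT_pos : ∀ n, 0 < T n) (hT_mono : ∀ n, T (n + 1) ≤ T n)
    (hT_sum : Summable (fun n => T n * Real.log n))
    (x0 : ℝ) (hx00 : x0 ∈ Set.Icc (0:ℝ) 1)
    (x y : ℕ → ℝ)
    (hinit : x 0 = x0)
    (hy : ∀ n, y (n + 1) = G (x n) (u (n + 1)))
    (hx : ∀ n, x (n + 1) =
      if v (n + 1) ≤ Real.exp ((φ (y (n + 1)) - φ (x n)) / T (n + 1))
      then y (n + 1) else x n) :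
    Tendsto (fun n => φ (x n)) atTop (nhds (sSup (φ '' Set.Icc 0 1))) := by
  obtain ⟨hφc, Mbar, hMink⟩ := hφ
  have hxmem : ∀ n, x n ∈ Set.Icc (0:ℝ) 1 := by
    intro n
    induction n with
    | zero => rwa [hinit]
    | succ n ih =>
      rw [hx, hy]
      split_ifs
      · exact (hG _ ih _ (Set.Ico_subset_Icc_self (hu.1 _))).1
      · exact ih
  have hymem : ∀ n, y (n + 1) ∈ Set.Icc (0:ℝ) 1 ∧ cdf1 κ (x n) (y (n + 1)) = u (n + 1) :=
    fun n => hy n ▸ hG _ (hxmem n) _ (Set.Ico_subset_Icc_self (hu.1 _))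
  obtain ⟨w, hw, hwmax⟩ := isCompact_Icc.exists_isMaxOn ⟨x0, hx00⟩ hφc
  have hsup : sSup (φ '' Set.Icc 0 1) = φ w :=
    IsGreatest.csSup_eq ⟨⟨w, hw, rfl⟩, by rintro _ ⟨z, hz, rfl⟩; exact hwmax hz⟩
  rw [hsup] at hMink ⊢
  have hlogb : 0 ≤ Real.log b := Real.log_natCast_nonneg b
  have hdecr : ∀ n, φ (x n) - T (n + 1) * (Real.log (n + 1 : ℕ) + Real.log b)
      ≤ φ (x (n + 1)) := by
    intro n
    have hTn := hT_pos (n + 1)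
    rw [hx]
    split_ifs with hacc
    · obtain ⟨hvpos, hvlog⟩ := hv.neg_log_le hb hv0 (Nat.succ_ne_zero n)
      have h1 := hvlog.trans ((Real.log_le_iff_le_exp hvpos).2 hacc)
      rw [le_div_iff₀ hTn] at h1
      linarith
    · have := mul_nonneg hTn.le (add_nonneg (Real.log_natCast_nonneg (n + 1)) hlogb)
      linarith
  have hsumm : Summable fun n => T (n + 1) * (Real.log (n + 1 : ℕ) + Real.log b) := by
    have h := hT_sum.add ((summable_of_summable_mul_log hT_pos hT_sum).mul_right (Real.log b))
    simp only [← mul_add] at h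
    exact (summable_nat_add_iff 1).2 h
  obtain ⟨L, hL⟩ := exists_tendsto_of_sub_le (f := fun n => φ (x n))
    (fun n => hwmax (hxmem n)) hsumm
    (fun n => mul_nonneg (hT_pos _).le (add_nonneg (Real.log_natCast_nonneg _) hlogb)) hdecr
  have hLle : L ≤ φ w := le_of_tendsto' hL fun n => hwmax (hxmem n)
  rcases hLle.eq_or_lt with rfl | hlt
  · exact hL
  exfalso
  obtain ⟨p, hp, hpL⟩ : L ∈ φ '' Set.Icc 0 1 :=
    (isCompact_Icc.image_of_continuousOn hφc).isClosed.mem_of_tendsto hL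
      (Filter.Eventually.of_forall fun n => ⟨x n, hxmem n, rfl⟩)
  obtain ⟨M, hM, -⟩ := hMink p hp (hpL ▸ hlt)
  rw [hpL] at hM
  have hfin := hM.finite fun z hz => hz.1
  have hSfin := (hfin.prod hfin).image fun z : ℝ × ℝ => cdf1 κ z.1 z.2
  have hS : ∀ x ∈ Set.Icc (0:ℝ) 1, ∀ y ∈ Set.Icc (0:ℝ) 1, φ x = L → φ y = L →
      cdf1 κ x y ∈ hSfin.toFinset := fun x hx y hy hxL hyL =>
    hSfin.mem_toFinset.2 ⟨(x, y), ⟨⟨hx, hxL⟩, hy, hyL⟩, rfl⟩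
  -- an interval on which `φ` exceeds a level strictly above `L`
  obtain ⟨l, hLl, hlw⟩ := exists_between hlt
  obtain ⟨ρ, hρ, hρl⟩ := Metric.mem_nhdsWithin_iff.1
    ((hφc w hw).eventually (lt_mem_nhds hlw))
  set ε := min (ρ / 2) (1 / 2) with hε
  have hε0 : 0 < ε := lt_min (by linarith) (by norm_num)
  obtain ⟨a, hasub, hadist⟩ := exists_Icc_add_subset_unit hw hε0.le (min_le_right _ _)
  have ha : a ∈ Set.Icc (0:ℝ) 1 := hasub ⟨le_rfl, by linarith⟩
  have haε : a + ε ∈ Set.Icc (0:ℝ) 1 := hasub ⟨by linarith, le_rfl⟩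
  have hhigh : ∀ z ∈ Set.Icc a (a + ε), l < φ z := fun z hz =>
    hρl ⟨by
      rw [Metric.mem_ball, Real.dist_eq]
      have := hadist z hz
      have := min_le_left (ρ / 2) (1 / 2 : ℝ)
      linarith, hasub hz⟩
  have hKpos : 0 < Klow * ε := mul_pos hA2.2.1 hε0
  have hbR : (1:ℝ) < b := by exact_mod_cast (show 1 < b by omega)
  obtain ⟨k, hk⟩ := pow_unbounded_of_one_lt (2 / (Klow * ε)) hbR
  have hk' : 2 / (b:ℝ) ^ k ≤ Klow * ε := by
    rw [div_lt_iff₀ hKpos] at hk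
    rw [div_le_iff₀ (by positivity)]
    linarith
  obtain ⟨η, hη, hblock⟩ :=
    hu.exists_block_avoiding hb (m := t + k) (Nat.le_add_right t k) hSfin.toFinset
  obtain ⟨δ, hδ, hnear⟩ := exists_forall_cdf1_near hA2 hφc hS hη
  obtain ⟨N, hN⟩ := eventually_atTop.1
    ((hL.eventually (gt_mem_nhds hLl)).and (Metric.tendsto_nhds.1 hL δ hδ))
  obtain ⟨c, hc, havoid⟩ := hblock (N + 1)
  have hconst : ∀ j < b ^ (t + k), x (c * b ^ (t + k) + j) = x (c * b ^ (t + k) - 1) := by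
    have hstay : ∀ n, N ≤ n → c * b ^ (t + k) ≤ n + 1 →
        n + 1 < c * b ^ (t + k) + b ^ (t + k) → x (n + 1) = x n := by
      intro n hNn hn1 hn2
      have hxn := hx n
      split_ifs at hxn with hacc
      · obtain ⟨s, hs, hlts⟩ := hnear _ (hxmem n) _ (hxmem (n + 1)) (hN n hNn).2
          (hN (n + 1) (by omega)).2
        rw [hxn, (hymem n).2] at hlts
        exact absurd (havoid _ hn1 hn2 s hs) (not_le.2 hlts)
      · exact hxn
    intro j
    induction j with
    | zero =>
      intro hj
      have := hstay (c * b ^ (t + k) - 1) (by omega) (by omega) (by omega)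
      rwa [Nat.sub_add_cancel (by omega)] at this
    | succ j ih =>
      intro hj
      rw [← ih (by omega), ← add_assoc]
      exact hstay _ (by omega) (by omega) (by omega)
  set z := x (c * b ^ (t + k) - 1) with hz
  have hzmem : z ∈ Set.Icc (0:ℝ) 1 := hxmem _
  have hF := cdf1_sub_ge hA2 hzmem ha.1 (by linarith : a ≤ a + ε) haε.2
  have hF0 : 0 ≤ cdf1 κ z a := by
    have hmono := (hA1 z hzmem).monotoneOn ⟨le_rfl, zero_le_one⟩ ha ha.1
    simpa [cdf1] using hmono
  have hF1 : cdf1 κ z (a + ε) ≤ 1 := by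
    have h1 : cdf1 κ z 1 = 1 := by
      rw [cdf1, intervalIntegral.integral_of_le zero_le_one, ← integral_Icc_eq_integral_Ioc]
      exact (hκ z hzmem).2
    exact h1 ▸ (hA1 z hzmem).monotoneOn haε ⟨zero_le_one, le_rfl⟩ haε.2
  obtain ⟨n, hn1, hn2, hn3, hn4⟩ := hu.exists_mem_Icc hb c (Nat.le_add_right t k) hF0 hF1
    (by rw [Nat.add_sub_cancel_left]; linarith)
  obtain ⟨n, rfl⟩ : ∃ n', n = n' + 1 := ⟨n - 1, by omega⟩
  have hxz : x n = z := by
    rcases Nat.eq_or_lt_of_le hn1 with h | h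
    · rw [hz, h, Nat.add_sub_cancel]
    · have := hconst (n - c * b ^ (t + k)) (by omega)
      rwa [Nat.add_sub_cancel' (by omega)] at this
  obtain ⟨hyI, hyF⟩ := hymem n
  rw [hxz] at hyF
  rw [← hyF, (hA1 z hzmem).le_iff_le ha hyI] at hn3
  rw [← hyF, (hA1 z hzmem).le_iff_le hyI haε] at hn4
  have hyl := hhigh _ ⟨hn3, hn4⟩
  have hxl := (hN n (by omega)).1
  have hacc : v (n + 1) ≤ Real.exp ((φ (y (n + 1)) - φ (x n)) / T (n + 1)) :=
    (hv.1 _).2.le.trans (Real.one_le_exp (div_nonneg (by linarith) (hT_pos _).le))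
  have hxl' := (hN (n + 1) (by omega)).1
  rw [hx, if_pos hacc] at hxl'
  exact lt_asymm hxl' hyl
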